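/- Alt_8 S^⧢[ Ĩ_{3,1}( ρ_{1,2}/ρ_1, ρ_{3,2}/ρ_{3,4} ) + Ĩ_{3,1}( CR(34|2567), CR(67|1345) ) ] = Alt_8 S^⧢[ V( ρ_2/ρ_1 ; −(1/2)(CR(34|2685), CR(48|7653)) + (1/2)(CR(48|7235), CR(48|7263)) + (1/4)(CR(46|5238), CR(43|2568)) ) ] in V_F^{⊗4}. -/

import Mathlib

open scoped TensorProduct
open PiTensorProduct

attribute [local instance] Classical.propDecidable

set_option maxHeartbeats 1000000
set_option synthInstance.maxHeartbeats 400000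

noncomputable section

namespace GrassPoly

variable (F : Type) [Field F]

/-- `V_F = F^× ⊗_ℤ ℚ` as a `ℚ`-vector space. -/
abbrev VF : Type := ℚ ⊗[ℤ] (Additive Fˣ)

variable {F}

/-- The class `[a]` of a nonzero field element in `V_F` (defined to be `0` for `a = 0`). -/
def cls (a : F) : VF F :=
  if h : a = 0 then 0 else (1 : ℚ) ⊗ₜ[ℤ] (Additive.ofMul (Units.mk0 a h))

variable (F) in
/-- Tensor powers of V_F over ℚ. -/
abbrev TP (n : ℕ) : Type := ⨂[ℚ]^n (VF F)

instance instTPAddCommGroup (n : ℕ) : AddCommGroup (TP F n) :=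
  Module.addCommMonoidToAddCommGroup ℚ

/-- Appending one extra tensor factor on the right. -/
def snoc {n : ℕ} : TP F n →ₗ[ℚ] VF F →ₗ[ℚ] TP F (n + 1) :=
  PiTensorProduct.lift
    ((PiTensorProduct.tprod ℚ (s := fun _ : Fin (n + 1) => VF F)).curryRight)

/-- The factor `t_i` appearing in the recursive definition of the symbol,
as a function of `(a_{i-1}, a_i, a_{i+1})`. -/
def tCoef (p a q : F) : VF F :=
  if p = a then (if a = q then 0 else cls (q - a))
  else if a = q then - cls (p - a)
  else cls ((q - a) / (p - a))

/-- The symbol `S I(a₀; a₁, …, a_m; a_{m+1})`, with the middle entries given as a list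
(of length `n`). -/
def SIaux : (n : ℕ) → (a0 : F) → (as : List F) → (b : F) → as.length = n → TP F n
  | 0, _, _, _, _ => tprod ℚ (fun i : Fin 0 => i.elim0)
  | n + 1, a0, as, b, h =>
      ∑ i : Fin (n + 1),
        snoc (SIaux n a0 (as.eraseIdx i.val) b
            (by
              have hi' := i.isLt
              have hi : i.val < as.length := by omega
              have h2 := List.length_eraseIdx_of_lt hi
              omega))
          (tCoef ((a0 :: as).getD i.val 0) (as.getD i.val 0) ((as ++ [b]).getD (i.val + 1) 0))

/-- Cyclic rotation `b₁ ⊗ … ⊗ b_N ↦ b₂ ⊗ … ⊗ b_N ⊗ b₁` on tensor powers. -/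
def rotN (n : ℕ) : TP F n ≃ₗ[ℚ] TP F n :=
  PiTensorProduct.reindex ℚ (fun _ : Fin n => VF F) (finRotate n).symm

/-- Splitting off the last tensor factor. -/
def splitLast (n : ℕ) : TP F (n + 1) ≃ₗ[ℚ] (TP F n) ⊗[ℚ] (VF F) :=
  ((PiTensorProduct.reindex ℚ (fun _ : Fin (n + 1) => VF F)
      (finSumFinEquiv (m := n) (n := 1)).symm).trans
    (PiTensorProduct.tmulEquiv ℚ (VF F)).symm).trans
    (TensorProduct.congr (LinearEquiv.refl ℚ _)
      (PiTensorProduct.subsingletonEquiv (0 : Fin 1)))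

/-- The projector `Π̃_N` annihilating symbols of products. -/
def Pit : (n : ℕ) → TP F n →ₗ[ℚ] TP F n
  | 0 => LinearMap.id
  | 1 => LinearMap.id
  | (n + 2) =>
      ((splitLast (n + 1)).symm.toLinearMap
        ∘ₗ TensorProduct.map (Pit (n + 1)) LinearMap.id
        ∘ₗ (splitLast (n + 1)).toLinearMap)
      ∘ₗ ((LinearMap.id : TP F (n + 2) →ₗ[ℚ] TP F (n + 2)) - (rotN (F := F) (n + 2)).toLinearMap)

/-- The map on `V_F` induced by a field automorphism. -/
def vmap (φ : F ≃+* F) : VF F →ₗ[ℚ] VF F :=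
  TensorProduct.AlgebraTensorModule.map (LinearMap.id : ℚ →ₗ[ℚ] ℚ)
    (AddMonoidHom.toIntLinearMap
      { toFun := fun a => Additive.ofMul ((Units.map (φ : F →* F)) a.toMul)
        map_zero' := by simp
        map_add' := by intro a b; simp [_root_.map_mul] })

/-- The induced map on tensor powers. -/
def tpMap {n : ℕ} (φ : F ≃+* F) : TP F n →ₗ[ℚ] TP F n :=
  PiTensorProduct.map (fun _ => vmap φ)


/-! ### Symbols of (multiple) polylogarithms -/

/-- Symbol of `Li₂`. -/
def SLi2 (x : F) : TP F 2 := - SIaux 2 0 [x⁻¹, 0] 1 rfl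

/-- Symbol of `Li₃`. -/
def SLi3 (x : F) : TP F 3 := - SIaux 3 0 [x⁻¹, 0, 0] 1 rfl

/-- Symbol of `Li₄`. -/
def SLi4 (x : F) : TP F 4 := - SIaux 4 0 [x⁻¹, 0, 0, 0] 1 rfl

/-- Symbol of `Li₅`. -/
def SLi5 (x : F) : TP F 5 := - SIaux 5 0 [x⁻¹, 0, 0, 0, 0] 1 rfl

/-- Symbol of `I_{3,1}(x,y) = I(0; x,0,0,y; 1)`. -/
def SI31 (x y : F) : TP F 4 := SIaux 4 0 [x, 0, 0, y] 1 rfl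

/-- Symbol of `I_{4,1}(x,y) = I(0; x,0,0,0,y; 1)`. -/
def SI41 (x y : F) : TP F 5 := SIaux 5 0 [x, 0, 0, 0, y] 1 rfl

/-- Symbol of `I⁺_{4,1}(x,y) = ½ (I_{4,1}(x,y) + I_{4,1}(x,y⁻¹))`. -/
def I41p (x y : F) : TP F 5 := (2 : ℚ)⁻¹ • (SI41 x y + SI41 x y⁻¹)

/-- The anharmonic orbit of `x`, together with the signs of the
corresponding permutations in `S₃`. -/
def anhList (x : F) : List (ℚ × F) :=
  [(1, x), (1, (1 - x)⁻¹), (1, 1 - x⁻¹), (-1, x⁻¹), (-1, 1 - x), (-1, x / (x - 1))]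

/-- Symbol of `Ĩ_{3,1}(x,y) = (1/36) Σ_{σ,π ∈ S₃} sgn(σ) sgn(π) I_{3,1}(x^σ, y^π)`. -/
def tI31 (x y : F) : TP F 4 :=
  (36 : ℚ)⁻¹ •
    ((anhList x).map (fun p =>
      ((anhList y).map (fun q => (p.1 * q.1) • SI31 p.2 q.2)).sum)).sum

/-- Symbol of `Ĩ⁺_{4,1}(x,y) = (1/6) Σ_{σ ∈ S₃} sgn(σ) I⁺_{4,1}(x^σ, y)`. -/
def tI41p (x y : F) : TP F 5 :=
  (6 : ℚ)⁻¹ • ((anhList x).map (fun p => p.1 • I41p p.2 y)).sum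

/-- Symbol of `V(z; x, y) = Ĩ_{3,1}(z, [x]+[y]+[(1-x)/(1-xy)]+[1-xy]+[(1-y)/(1-xy)])`. -/
def Vc (z x y : F) : TP F 4 :=
  tI31 z x + tI31 z y + tI31 z ((1 - x) / (1 - x * y)) + tI31 z (1 - x * y)
    + tI31 z ((1 - y) / (1 - x * y))

/-- `Sym₃₆(a,b) := I_{3,1}(a,b) - Ĩ_{3,1}(a,b)` (on the level of symbols). -/
def S36 (a b : F) : TP F 4 := SI31 a b - tI31 a b

/-! ### Generic vectors -/

variable (N m : ℕ)

/-- Polynomial ring on the entries of `N` generic vectors in `m`-space. -/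
abbrev Pol : Type := MvPolynomial (Fin N × Fin m) ℚ

/-- The field of rational functions in the entries of `N` generic vectors in `m`-space. -/
abbrev FF : Type := FractionRing (Pol N m)

/-- The `j`-th coordinate of the `i`-th generic vector. -/
def gen (i : Fin N) (j : Fin m) : FF N m :=
  algebraMap (Pol N m) (FF N m) (MvPolynomial.X (i, j))

/-- `⟨i₁ … i_m⟩`: the determinant of the matrix whose columns are
the generic vectors selected by `cols`. -/
def dets (cols : Fin m → Fin N) : FF N m :=
  (Matrix.of fun r c => gen N m (cols c) r).det

/-- The field automorphism of `FF N m` induced by a permutation of the `N` vectors. -/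
def permAut (σ : Equiv.Perm (Fin N)) : FF N m ≃+* FF N m :=
  IsFractionRing.ringEquivOfRingEquiv
    ((MvPolynomial.renameEquiv ℚ (σ.prodCongr (Equiv.refl (Fin m)))).toRingEquiv)

variable {N m}

/-- Skew-symmetrization over all permutations of the `N` generic vectors. -/
def Alt {n : ℕ} (x : TP (FF N m) n) : TP (FF N m) n :=
  ∑ σ : Equiv.Perm (Fin N), (((Equiv.Perm.sign σ : ℤˣ) : ℤ) : ℚ) • tpMap (permAut N m σ) x

end GrassPoly

end

namespace GrassPoly

noncomputable section W4

/-- The field of rational functions in the entries of 8 generic vectors in 4-space. -/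
abbrev K4 : Type := FF 8 4

/-- The vector label `k ∈ {1, …, 8}` as an index. -/
def L8 (k : ℕ) : Fin 8 := ⟨(k - 1) % 8, Nat.mod_lt _ (by norm_num)⟩

/-- `⟨abcd⟩` for vector labels in `{1, …, 8}`. -/
def d4 (a b c d : ℕ) : K4 := dets 8 4 ![L8 a, L8 b, L8 c, L8 d]

/-- Vector labels taken mod 6 in `{1, …, 6}`. -/
def M6 (j : ℕ) : ℕ := (j - 1) % 6 + 1

/-- `ρ_i = ρ_{i,i+1,i+2} = ⟨i,i+1,i+2,7⟩ / ⟨i,i+1,i+2,8⟩`, indices mod 6. -/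
def rho (i : ℕ) : K4 :=
  d4 (M6 i) (M6 (i + 1)) (M6 (i + 2)) 7 / d4 (M6 i) (M6 (i + 1)) (M6 (i + 2)) 8

/-- `ρ_{i,j} = ρ_i - ρ_j`. -/
def rr (i j : ℕ) : K4 := rho i - rho j

/-- The projected cross-ratio `CR(ab|cdef) = ⟨abce⟩⟨abdf⟩ / (⟨abcf⟩⟨abde⟩)`. -/
def CR (a b c d e f : ℕ) : K4 :=
  (d4 a b c e * d4 a b d f) / (d4 a b c f * d4 a b d e)

/-- The symbol `S(Gr₄) = 2·(4!)²·Alt₈ [⟨1234⟩ ⊗ ⟨2345⟩ ⊗ ⟨3456⟩ ⊗ ⟨4567⟩]`. -/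
def SGr4 : TP K4 4 :=
  ((2 : ℚ) * ((Nat.factorial 4 : ℚ)) ^ 2) •
    Alt (tprod ℚ ![cls (d4 1 2 3 4), cls (d4 2 3 4 5), cls (d4 3 4 5 6), cls (d4 4 5 6 7)])

/-- An elementary tensor in `V_F^{⊗4}`. -/
def tp4 (a b c d : VF K4) : TP K4 4 := tprod ℚ ![a, b, c, d]

end W4

end GrassPoly

namespace GrassPoly

section TensorAlgebra

variable {F : Type} [Field F]

theorem snoc_tprod {n : ℕ} (f : Fin n → VF F) (v : VF F) :
    snoc (tprod ℚ f) v = tprod ℚ (Fin.snoc (α := fun _ => VF F) f v) := by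
  simp only [snoc, PiTensorProduct.lift.tprod]
  rfl

theorem splitLast_tprod {n : ℕ} (f : Fin (n + 1) → VF F) :
    splitLast n (tprod ℚ f) = tprod ℚ (fun i : Fin n => f i.castSucc) ⊗ₜ[ℚ] f (Fin.last n) := by
  simp only [splitLast, LinearEquiv.trans_apply, PiTensorProduct.reindex_tprod]
  erw [PiTensorProduct.tmulEquiv_symm_apply]
  simp only [TensorProduct.congr_tmul, LinearEquiv.refl_apply]
  erw [PiTensorProduct.subsingletonEquiv_apply_tprod]
  rfl

theorem splitLast_snoc {n : ℕ} (t : TP F n) (v : VF F) :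
    splitLast n (snoc t v) = t ⊗ₜ[ℚ] v := by
  induction t using PiTensorProduct.induction_on with
  | smul_tprod r f =>
    rw [map_smul, LinearMap.smul_apply, map_smul, snoc_tprod, splitLast_tprod]
    simp [TensorProduct.smul_tmul']
  | add a b ha hb => rw [map_add, LinearMap.add_apply, map_add, ha, hb, TensorProduct.add_tmul]

theorem Pit_tprod {n : ℕ} (f : Fin (n + 2) → VF F) :
    Pit (n + 2) (tprod ℚ f) =
      snoc (Pit (n + 1) (tprod ℚ (Fin.init (α := fun _ => VF F) f))) (f (Fin.last _))
        - snoc (Pit (n + 1) (tprod ℚ (Fin.tail (α := fun _ => VF F) f))) (f 0) := by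
  have h : rotN (n + 2) (tprod ℚ f) = tprod ℚ (fun i => f (finRotate (n + 2) i)) := by
    simp only [rotN, PiTensorProduct.reindex_tprod]
    rfl
  rw [Pit, LinearMap.comp_apply, LinearMap.sub_apply, map_sub, LinearMap.id_apply,
    LinearEquiv.coe_coe, h]
  simp only [LinearMap.comp_apply, LinearEquiv.coe_coe, splitLast_tprod, TensorProduct.map_tmul,
    LinearMap.id_apply, finRotate_last]
  simp only [← splitLast_snoc, LinearEquiv.symm_apply_apply]
  congr 5
  ext i
  simp [Fin.tail]

/-- The elementary tensor `a ⊗ b ⊗ c ⊗ d`, built by successive appending. -/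
def word (a b c d : VF F) : TP F 4 :=
  snoc (snoc (snoc (snoc (tprod ℚ (fun i : Fin 0 => i.elim0)) a) b) c) d

theorem word_eq_tprod (a b c d : VF F) : word a b c d = tprod ℚ ![a, b, c, d] := by
  simp only [word, snoc_tprod]
  congr 1
  ext i
  fin_cases i <;> rfl

theorem Pit_word (a b c d : VF F) :
    Pit 4 (word a b c d) =
      word a b c d - word b a c d - word b c a d + word c b a d
        - word b c d a + word c b d a + word c d b a - word d c b a := by
  have h1 (u : Fin 1 → VF F) : tprod ℚ u = snoc (tprod ℚ (fun i : Fin 0 => i.elim0)) (u 0) := by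
    rw [snoc_tprod]
    congr 1
    ext i
    fin_cases i; rfl
  have h2 (u : Fin 2 → VF F) := Pit_tprod (n := 0) u
  have h3 (u : Fin 3 → VF F) := Pit_tprod (n := 1) u
  have h4 (u : Fin 4 → VF F) := Pit_tprod (n := 2) u
  simp only [Nat.reduceAdd] at h2 h3 h4
  conv_lhs => rw [word_eq_tprod]
  have h0 (t : TP F 1) : Pit 1 t = t := rfl
  simp only [h4, h3, h2, h0, h1, map_sub, LinearMap.sub_apply]
  simp only [word, Fin.init, Fin.tail]
  simp
  abel

end TensorAlgebra

section Symbols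

variable {F : Type} [Field F]

theorem Pit_shuffle (a b c d : VF F) :
    Pit 4 (word a b c d) + Pit 4 (word a c b d) + Pit 4 (word a c d b)
      + Pit 4 (word c a b d) + Pit 4 (word c a d b) + Pit 4 (word c d a b) = 0 := by
  simp only [Pit_word]
  abel

theorem cls_one : cls (1 : F) = 0 := by
  simp [cls]

theorem cls_mul {a b : F} (ha : a ≠ 0) (hb : b ≠ 0) : cls (a * b) = cls a + cls b := by
  simp only [cls, mul_ne_zero ha hb, ha, hb, dite_false, ← TensorProduct.tmul_add, ← ofMul_mul]
  congr 2
  ext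
  simp

theorem cls_inv (a : F) : cls a⁻¹ = -cls a := by
  by_cases ha : a = 0
  · simp [ha, cls]
  · rw [eq_neg_iff_add_eq_zero, ← cls_mul (inv_ne_zero ha) ha, inv_mul_cancel₀ ha, cls_one]

theorem cls_div {a b : F} (ha : a ≠ 0) (hb : b ≠ 0) : cls (a / b) = cls a - cls b := by
  rw [div_eq_mul_inv, cls_mul ha (inv_ne_zero hb), cls_inv, sub_eq_add_neg]

theorem cls_neg (a : F) : cls (-a) = cls a := by
  by_cases ha : a = 0
  · simp [ha]
  · have h1 : cls (-1 : F) = 0 := by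
      have h : (2 : ℚ) • cls (-1 : F) = 0 := by
        rw [two_smul, ← cls_mul (by simp) (by simp)]
        simp [cls_one]
      exact (smul_eq_zero.mp h).resolve_left (by norm_num)
    rw [← neg_one_mul, cls_mul (by simp) ha, h1, zero_add]

theorem SIaux_one (p a q : F) :
    SIaux 1 p [a] q rfl = snoc (tprod ℚ (fun i : Fin 0 => i.elim0)) (tCoef p a q) := by
  rw [SIaux, Fin.sum_univ_one]
  rfl

theorem SIaux_two (p a b q : F) :
    SIaux 2 p [a, b] q rfl =
      snoc (SIaux 1 p [b] q rfl) (tCoef p a b) + snoc (SIaux 1 p [a] q rfl) (tCoef a b q) := by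
  rw [SIaux, Fin.sum_univ_two]
  rfl

theorem SIaux_three (p a b c q : F) :
    SIaux 3 p [a, b, c] q rfl =
      snoc (SIaux 2 p [b, c] q rfl) (tCoef p a b) + snoc (SIaux 2 p [a, c] q rfl) (tCoef a b c)
        + snoc (SIaux 2 p [a, b] q rfl) (tCoef b c q) := by
  rw [SIaux, Fin.sum_univ_three]
  rfl

theorem SIaux_four (p a b c d q : F) :
    SIaux 4 p [a, b, c, d] q rfl =
      snoc (SIaux 3 p [b, c, d] q rfl) (tCoef p a b) + snoc (SIaux 3 p [a, c, d] q rfl) (tCoef a b c)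
        + snoc (SIaux 3 p [a, b, d] q rfl) (tCoef b c d)
        + snoc (SIaux 3 p [a, b, c] q rfl) (tCoef c d q) := by
  rw [SIaux, Fin.sum_univ_four]
  rfl

theorem tCoef_ends_eq {p a : F} (h : p ≠ a) : tCoef p a p = 0 := by
  simp [tCoef, h, h.symm, div_self (sub_ne_zero.mpr h), cls_one]

theorem tCoef_left_eq (a q : F) : tCoef a a q = cls (q - a) := by
  by_cases h : a = q <;> simp [tCoef, h, cls]

theorem tCoef_right_eq (p a : F) : tCoef p a a = -cls (p - a) := by
  by_cases h : p = a <;> simp [tCoef, h, cls]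

theorem tCoef_eq {p a q : F} (h : p ≠ a ∨ a ≠ q) : tCoef p a q = cls (q - a) - cls (p - a) := by
  by_cases h1 : p = a
  · subst h1
    rw [tCoef_left_eq]
    simp [cls]
  · by_cases h2 : a = q
    · subst h2
      rw [tCoef_right_eq]
      simp [cls]
    · rw [tCoef, if_neg h1, if_neg h2, cls_div (sub_ne_zero.mpr (Ne.symm h2)) (sub_ne_zero.mpr h1)]

/-- The symbol of `I_{3,1}(x, y)` in terms of `X = [x]`, `X' = [1 - x]`, `Y = [y]`, `Y' = [1 - y]`
and `D = [x - y]`. -/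
theorem SI31_eq {x y : F} (hx0 : x ≠ 0) (hy0 : y ≠ 0) {X X' Y Y' D : VF F} (hX : cls x = X)
    (hX' : cls (1 - x) = X') (hY : cls y = Y) (hY' : cls (1 - y) = Y') (hD : cls (x - y) = D) :
    SI31 x y =
      word (Y' - Y) (D - X) (Y - X) (Y - X) + word (X' - X) (Y' - D) (Y - X) (Y - X)
        - word (X' - X) X (Y' - Y) (Y - X) + word (X' - X) X X (Y' - Y) := by
  have hD' : cls (y - x) = D := by rw [← hD, ← cls_neg, neg_sub]
  have h1 : tCoef 0 x y = D - X := by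
    rw [tCoef_eq (Or.inl hx0.symm), hD', zero_sub, cls_neg, hX]
  have hc0 : cls (0 : F) = 0 := by simp [cls]
  have h2 : tCoef x y 1 = Y' - D := by
    by_cases h : x = y
    · subst h
      rw [tCoef_left_eq, hY', ← hD, sub_self, hc0, sub_zero]
    · rw [tCoef_eq (Or.inl h), hY', hD]
  have h3 : ∀ z : F, z ≠ 0 → tCoef 0 z 1 = cls (1 - z) - cls z := fun z hz => by
    rw [tCoef_eq (Or.inl hz.symm), zero_sub, cls_neg]
  have h4 : tCoef x 0 y = Y - X := by
    rw [tCoef_eq (Or.inl hx0), sub_zero, sub_zero, hX, hY]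
  have h5 : tCoef x 0 1 = -X := by
    rw [tCoef_eq (Or.inl hx0), sub_zero, sub_zero, hX, cls_one, zero_sub]
  have h6 : tCoef x 0 0 = -X := by rw [tCoef_right_eq, sub_zero, hX]
  have h7 : tCoef 0 0 y = Y := by rw [tCoef_left_eq, sub_zero, hY]
  have h8 : tCoef (0 : F) 0 1 = 0 := by rw [tCoef_left_eq, sub_zero, cls_one]
  simp only [SI31, SIaux_four, SIaux_three, SIaux_two, SIaux_one, tCoef_ends_eq hx0.symm, h1, h2,
    h3 x hx0, h3 y hy0, h4, h5, h6, h7, h8, hX, hX', hY, hY', map_zero, word, map_add, map_sub,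
    map_neg, LinearMap.add_apply, LinearMap.sub_apply, LinearMap.neg_apply, LinearMap.zero_apply]
  abel

end Symbols

section Symmetries

variable {F : Type} [Field F]

theorem Pit_shuffle_three_one (a b c d : VF F) :
    Pit 4 (word a b c d) + Pit 4 (word a b d c) + Pit 4 (word a d b c) + Pit 4 (word d a b c) =
      0 := by
  simp only [Pit_word]
  abel

theorem Pit_SI31_swap {x y : F} (hx : x ≠ 0) (hy : y ≠ 0) :
    Pit 4 (SI31 y x) = -Pit 4 (SI31 x y) := by
  obtain ⟨X, hX⟩ : ∃ X, cls x = X := ⟨_, rfl⟩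
  obtain ⟨X', hX'⟩ : ∃ X', cls (1 - x) = X' := ⟨_, rfl⟩
  obtain ⟨Y, hY⟩ : ∃ Y, cls y = Y := ⟨_, rfl⟩
  obtain ⟨Y', hY'⟩ : ∃ Y', cls (1 - y) = Y' := ⟨_, rfl⟩
  obtain ⟨D, hD⟩ : ∃ D, cls (x - y) = D := ⟨_, rfl⟩
  have hD' : cls (y - x) = D := by rw [← hD, ← cls_neg, neg_sub]
  obtain ⟨A, hA⟩ : ∃ A, A = X' - X := ⟨_, rfl⟩
  obtain ⟨B, hB⟩ : ∃ B, B = Y' - Y := ⟨_, rfl⟩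
  have key : SI31 x y + SI31 y x =
      (word A X X B + word A X B X + word A B X X + word B A X X)
      + (word B Y Y A + word B Y A Y + word B A Y Y + word A B Y Y)
      - (word A X B Y + word A B X Y + word A B Y X + word B A X Y + word B A Y X
        + word B Y A X) := by
    rw [SI31_eq hx hy hX hX' hY hY' hD, SI31_eq hy hx hY hY' hX hX' hD', ← hA, ← hB]
    obtain rfl : X' = A + X := by rw [hA]; abel
    obtain rfl : Y' = B + Y := by rw [hB]; abel
    simp only [word, map_add, map_sub, LinearMap.add_apply, LinearMap.sub_apply]
    abel
  rw [eq_neg_iff_add_eq_zero, add_comm, ← map_add, key, map_sub]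
  simp only [map_add]
  rw [Pit_shuffle_three_one, Pit_shuffle_three_one, Pit_shuffle]
  simp

/-- The signed sum of `f` over the anharmonic orbit of `x`. -/
def anhSum {M : Type} [AddCommGroup M] (f : F → M) (x : F) : M :=
  f x + f (1 - x)⁻¹ + f (1 - x⁻¹) - f x⁻¹ - f (1 - x) - f (x / (x - 1))

theorem anhSum_inv {M : Type} [AddCommGroup M] (f : F → M) {x : F} (h0 : x ≠ 0) (h1 : x ≠ 1) :
    anhSum f x⁻¹ = -anhSum f x := by
  have h2 : x - 1 ≠ 0 := sub_ne_zero.mpr h1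
  have e1 : (1 - x⁻¹)⁻¹ = x / (x - 1) := by
    rw [show 1 - x⁻¹ = (x - 1) / x by field_simp, inv_div]
  have e2 : x⁻¹ / (x⁻¹ - 1) = (1 - x)⁻¹ := by
    have h3 : 1 - x ≠ 0 := sub_ne_zero.mpr h1.symm
    rw [show x⁻¹ - 1 = (1 - x) / x by field_simp, div_div_eq_mul_div, inv_mul_cancel₀ h0, one_div]
  rw [anhSum, anhSum, inv_inv, e1, e2]
  abel

theorem anhSum_one_sub {M : Type} [AddCommGroup M] (f : F → M) {x : F} (h0 : x ≠ 0) (h1 : x ≠ 1) :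
    anhSum f (1 - x) = -anhSum f x := by
  have h2 : x - 1 ≠ 0 := sub_ne_zero.mpr h1
  have h3 : 1 - x ≠ 0 := sub_ne_zero.mpr h1.symm
  have e1 : 1 - (1 - x)⁻¹ = x / (x - 1) := by
    rw [← neg_sub x 1]
    field_simp
    ring
  have e2 : (1 - x) / (1 - x - 1) = 1 - x⁻¹ := by
    rw [show 1 - x - 1 = -x by ring]
    field_simp
    ring
  rw [anhSum, anhSum, sub_sub_cancel, e1, e2]
  abel

theorem tI31_eq_anhSum (x y : F) :
    tI31 x y = (36 : ℚ)⁻¹ • anhSum (fun u => anhSum (fun v => SI31 u v) y) x := by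
  have key (g : F → F → TP F 4) :
      ((anhList x).map (fun p => ((anhList y).map (fun q => (p.1 * q.1) • g p.2 q.2)).sum)).sum
        = anhSum (fun u => anhSum (fun v => g u v) y) x := by
    simp only [anhList, List.map_cons, List.map_nil, List.sum_cons, List.sum_nil,
      anhSum, mul_neg, mul_one, neg_smul, one_smul, neg_neg]
    abel
  rw [tI31, key]

theorem tI31_inv_left {x : F} (h0 : x ≠ 0) (h1 : x ≠ 1) (y : F) : tI31 x⁻¹ y = -tI31 x y := by
  rw [tI31_eq_anhSum, anhSum_inv _ h0 h1, smul_neg, tI31_eq_anhSum]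

theorem tI31_one_sub_left {x : F} (h0 : x ≠ 0) (h1 : x ≠ 1) (y : F) :
    tI31 (1 - x) y = -tI31 x y := by
  rw [tI31_eq_anhSum, anhSum_one_sub _ h0 h1, smul_neg, tI31_eq_anhSum]

theorem anhSum_neg {M : Type} [AddCommGroup M] (f : F → M) (x : F) :
    anhSum (fun u => -f u) x = -anhSum f x := by
  simp only [anhSum]
  abel

theorem anhSum_comm {M : Type} [AddCommGroup M] (f : F → F → M) (x y : F) :
    anhSum (fun u => anhSum (fun v => f u v) y) x =
      anhSum (fun v => anhSum (fun u => f u v) x) y := by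
  simp only [anhSum]
  abel

theorem anhSum_congr {M : Type} [AddCommGroup M] {f g : F → M} {x : F} (h0 : x ≠ 0) (h1 : x ≠ 1)
    (h : ∀ u, u ≠ 0 → f u = g u) : anhSum f x = anhSum g x := by
  have h2 : x - 1 ≠ 0 := sub_ne_zero.mpr h1
  have h3 : 1 - x ≠ 0 := sub_ne_zero.mpr h1.symm
  have h4 : 1 - x⁻¹ ≠ 0 := by
    rw [sub_ne_zero]
    exact fun e => h1 (by rw [← inv_inv x, ← e, inv_one])
  rw [anhSum, anhSum, h _ h0, h _ (inv_ne_zero h3), h _ h4, h _ (inv_ne_zero h0), h _ h3,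
    h _ (div_ne_zero h0 h2)]

theorem map_anhSum {M N : Type} [AddCommGroup M] [AddCommGroup N] [Module ℚ M] [Module ℚ N]
    (L : M →ₗ[ℚ] N) (f : F → M) (x : F) : L (anhSum f x) = anhSum (fun u => L (f u)) x := by
  simp only [anhSum, map_add, map_sub]

theorem Pit_tI31_swap {x y : F} (hx0 : x ≠ 0) (hx1 : x ≠ 1) (hy0 : y ≠ 0) (hy1 : y ≠ 1) :
    Pit 4 (tI31 y x) = -Pit 4 (tI31 x y) := by
  have key : anhSum (fun u => anhSum (fun v => Pit 4 (SI31 v u)) y) x =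
      anhSum (fun u => anhSum (fun v => -Pit 4 (SI31 u v)) y) x :=
    anhSum_congr hx0 hx1 fun u hu => anhSum_congr hy0 hy1 fun v hv => Pit_SI31_swap hu hv
  rw [tI31_eq_anhSum, tI31_eq_anhSum, map_smul, map_smul, ← smul_neg, anhSum_comm]
  simp only [map_anhSum]
  rw [key]
  simp only [anhSum_neg]

theorem tI31_inv_right (x : F) {y : F} (h0 : y ≠ 0) (h1 : y ≠ 1) : tI31 x y⁻¹ = -tI31 x y := by
  simp only [tI31_eq_anhSum, anhSum_inv _ h0 h1, anhSum_neg, smul_neg]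

theorem tI31_one_sub_right (x : F) {y : F} (h0 : y ≠ 0) (h1 : y ≠ 1) :
    tI31 x (1 - y) = -tI31 x y := by
  simp only [tI31_eq_anhSum, anhSum_one_sub _ h0 h1, anhSum_neg, smul_neg]

end Symmetries

section Equivariance

variable {F : Type} [Field F]

theorem vmap_cls (φ : F ≃+* F) (a : F) : vmap φ (cls a) = cls (φ a) := by
  by_cases h : a = 0
  · simp [cls, h]
  · have h' : φ a ≠ 0 := by simpa using h
    simp only [cls, h, h', dite_false, vmap, TensorProduct.AlgebraTensorModule.map_tmul,
      LinearMap.id_apply]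
    refine congrArg (fun w => (1 : ℚ) ⊗ₜ[ℤ] w) (Additive.toMul.injective (Units.ext ?_))
    rfl

theorem vmap_tCoef (φ : F ≃+* F) (p a q : F) :
    vmap φ (tCoef p a q) = tCoef (φ p) (φ a) (φ q) := by
  simp only [tCoef, φ.injective.eq_iff]
  split_ifs <;> simp [vmap_cls]

theorem tpMap_snoc {n : ℕ} (φ : F ≃+* F) (t : TP F n) (v : VF F) :
    tpMap φ (snoc t v) = snoc (tpMap φ t) (vmap φ v) := by
  induction t using PiTensorProduct.induction_on with
  | smul_tprod r f =>
    simp only [map_smul, LinearMap.smul_apply, snoc_tprod, tpMap, PiTensorProduct.map_tprod]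
    congr 2
    ext i
    refine Fin.lastCases ?_ (fun j => ?_) i <;> simp
  | add a b ha hb => simp only [map_add, LinearMap.add_apply, ha, hb]

theorem tpMap_SI31 (φ : F ≃+* F) (x y : F) : tpMap φ (SI31 x y) = SI31 (φ x) (φ y) := by
  have h0 : tpMap φ (tprod ℚ (fun i : Fin 0 => i.elim0)) =
      tprod ℚ (fun i : Fin 0 => (i.elim0 : VF F)) := by
    rw [tpMap, PiTensorProduct.map_tprod]
    congr 1
    ext i
    exact i.elim0
  have h1 (t : TP F 0) (v : VF F) : tpMap φ (snoc t v : TP F 1) = snoc (tpMap φ t) (vmap φ v) :=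
    tpMap_snoc φ t v
  have h2 (t : TP F 1) (v : VF F) : tpMap φ (snoc t v : TP F 2) = snoc (tpMap φ t) (vmap φ v) :=
    tpMap_snoc φ t v
  have h3 (t : TP F 2) (v : VF F) : tpMap φ (snoc t v : TP F 3) = snoc (tpMap φ t) (vmap φ v) :=
    tpMap_snoc φ t v
  have h4 (t : TP F 3) (v : VF F) : tpMap φ (snoc t v : TP F 4) = snoc (tpMap φ t) (vmap φ v) :=
    tpMap_snoc φ t v
  simp only [SI31, SIaux_four, SIaux_three, SIaux_two, SIaux_one, map_add, LinearMap.add_apply, h1, h2, h3, h4,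
    vmap_tCoef, h0, map_zero, map_one]

theorem tpMap_Pit {n : ℕ} (φ : F ≃+* F) (t : TP F n) : tpMap φ (Pit n t) = Pit n (tpMap φ t) := by
  match n with
  | 0 => rfl
  | 1 => rfl
  | n + 2 =>
    induction t using PiTensorProduct.induction_on with
    | smul_tprod r f =>
      simp only [map_smul, Pit_tprod, map_sub, tpMap_snoc, tpMap_Pit]
      simp only [tpMap, PiTensorProduct.map_tprod, Pit_tprod]
      rfl
    | add a b ha hb => simp only [map_add, ha, hb]

theorem tpMap_tI31 (φ : F ≃+* F) (x y : F) : tpMap φ (tI31 x y) = tI31 (φ x) (φ y) := by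
  simp only [tI31_eq_anhSum, map_smul, map_anhSum, tpMap_SI31]
  simp only [anhSum, map_sub, map_inv₀, map_div₀, map_one]

variable {N m : ℕ}

theorem permAut_mul_apply (σ τ : Equiv.Perm (Fin N)) (a : FF N m) :
    permAut N m (σ * τ) a = permAut N m σ (permAut N m τ a) := by
  have h : permAut N m (σ * τ) = (permAut N m τ).trans (permAut N m σ) := by
    rw [permAut, permAut, permAut, ← IsFractionRing.ringEquivOfRingEquiv_comp]
    congr 1
    ext p
    simp [MvPolynomial.rename_rename]
    rfl
  rw [h]
  rfl

theorem vmap_permAut_mul (σ τ : Equiv.Perm (Fin N)) :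
    vmap (permAut N m (σ * τ)) = vmap (permAut N m σ) ∘ₗ vmap (permAut N m τ) := by
  apply TensorProduct.AlgebraTensorModule.ext
  intro r a
  simp only [vmap, TensorProduct.AlgebraTensorModule.map_tmul, LinearMap.comp_apply,
    LinearMap.id_apply]
  congr 1
  apply Additive.toMul.injective
  ext
  exact permAut_mul_apply σ τ _

theorem tpMap_permAut_mul {n : ℕ} (σ τ : Equiv.Perm (Fin N)) (t : TP (FF N m) n) :
    tpMap (permAut N m (σ * τ)) t = tpMap (permAut N m σ) (tpMap (permAut N m τ) t) := by
  simp only [tpMap, vmap_permAut_mul, PiTensorProduct.map_comp, LinearMap.comp_apply]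

theorem Alt_tpMap_permAut {n : ℕ} (τ : Equiv.Perm (Fin N)) (t : TP (FF N m) n) :
    Alt (tpMap (permAut N m τ) t) = (((Equiv.Perm.sign τ : ℤˣ) : ℤ) : ℚ) • Alt t := by
  rw [Alt, Alt, Finset.smul_sum]
  refine Fintype.sum_equiv (Equiv.mulRight τ) _ _ fun σ => ?_
  rw [Equiv.coe_mulRight, tpMap_permAut_mul, smul_smul, Equiv.Perm.sign_mul]
  congr 1
  rcases Int.units_eq_one_or (Equiv.Perm.sign τ) with h | h <;> simp [h]

theorem permAut_dets (σ : Equiv.Perm (Fin N)) (c : Fin m → Fin N) :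
    permAut N m σ (dets N m c) = dets N m (σ ∘ c) := by
  rw [dets, dets, RingEquiv.map_det]
  congr 1
  ext r s
  simp [gen, permAut]

end Equivariance

noncomputable section Minors

/-- The determinant of four vectors in `4`-space, expanded. -/
theorem det_four {R : Type} [CommRing R] (u : Fin 4 → Fin 4 → R) :
    (Matrix.of fun r c => u c r).det =
      (u 0 0 * u 1 1 - u 0 1 * u 1 0) * (u 2 2 * u 3 3 - u 2 3 * u 3 2)
      - (u 0 0 * u 1 2 - u 0 2 * u 1 0) * (u 2 1 * u 3 3 - u 2 3 * u 3 1)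
      + (u 0 0 * u 1 3 - u 0 3 * u 1 0) * (u 2 1 * u 3 2 - u 2 2 * u 3 1)
      + (u 0 1 * u 1 2 - u 0 2 * u 1 1) * (u 2 0 * u 3 3 - u 2 3 * u 3 0)
      - (u 0 1 * u 1 3 - u 0 3 * u 1 1) * (u 2 0 * u 3 2 - u 2 2 * u 3 0)
      + (u 0 2 * u 1 3 - u 0 3 * u 1 2) * (u 2 0 * u 3 1 - u 2 1 * u 3 0) := by
  simp [Matrix.det_succ_row_zero, Fin.sum_univ_succ, Fin.succAbove]
  ring

theorem d4_eq (a b c d : ℕ) (g : ℕ → Fin 4 → K4) (hg : ∀ k, g k = gen 8 4 (L8 k)) :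
    d4 a b c d =
      (g a 0 * g b 1 - g a 1 * g b 0) * (g c 2 * g d 3 - g c 3 * g d 2)
      - (g a 0 * g b 2 - g a 2 * g b 0) * (g c 1 * g d 3 - g c 3 * g d 1)
      + (g a 0 * g b 3 - g a 3 * g b 0) * (g c 1 * g d 2 - g c 2 * g d 1)
      + (g a 1 * g b 2 - g a 2 * g b 1) * (g c 0 * g d 3 - g c 3 * g d 0)
      - (g a 1 * g b 3 - g a 3 * g b 1) * (g c 0 * g d 2 - g c 2 * g d 0)
      + (g a 2 * g b 3 - g a 3 * g b 2) * (g c 0 * g d 1 - g c 1 * g d 0) := by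
  simp only [hg]
  exact det_four fun i => gen 8 4 (![L8 a, L8 b, L8 c, L8 d] i)

theorem d4_swap_one (a b c d : ℕ) : d4 b a c d = -d4 a b c d := by
  obtain ⟨g, hg⟩ : ∃ g : ℕ → Fin 4 → K4, ∀ k, g k = gen 8 4 (L8 k) := ⟨_, fun _ => rfl⟩
  rw [d4_eq _ _ _ _ g hg, d4_eq _ _ _ _ g hg]
  ring

theorem d4_swap_two (a b c d : ℕ) : d4 a c b d = -d4 a b c d := by
  obtain ⟨g, hg⟩ : ∃ g : ℕ → Fin 4 → K4, ∀ k, g k = gen 8 4 (L8 k) := ⟨_, fun _ => rfl⟩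
  rw [d4_eq _ _ _ _ g hg, d4_eq _ _ _ _ g hg]
  ring

theorem d4_swap_three (a b c d : ℕ) : d4 a b d c = -d4 a b c d := by
  obtain ⟨g, hg⟩ : ∃ g : ℕ → Fin 4 → K4, ∀ k, g k = gen 8 4 (L8 k) := ⟨_, fun _ => rfl⟩
  rw [d4_eq _ _ _ _ g hg, d4_eq _ _ _ _ g hg]
  ring

/-! As simp lemmas the following three sort the arguments of `d4`: the inequalities make the
rewriting terminate. -/

@[simp]
theorem d4_sort_one {a b c d : ℕ} (_h : b < a) : d4 a b c d = -d4 b a c d := d4_swap_one b a c d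

@[simp]
theorem d4_sort_two {a b c d : ℕ} (_h : c < b) : d4 a b c d = -d4 a c b d := d4_swap_two a c b d

@[simp]
theorem d4_sort_three {a b c d : ℕ} (_h : d < c) : d4 a b c d = -d4 a b d c :=
  d4_swap_three a b d c

/-- The three-term Plücker relation. -/
theorem d4_plucker (a b c d e f : ℕ) :
    d4 a b c d * d4 a b e f - d4 a b c e * d4 a b d f + d4 a b c f * d4 a b d e = 0 := by
  obtain ⟨g, hg⟩ : ∃ g : ℕ → Fin 4 → K4, ∀ k, g k = gen 8 4 (L8 k) := ⟨_, fun _ => rfl⟩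
  simp only [d4_eq _ _ _ _ g hg]
  ring

/-- The minor `⟨abcd⟩` as a polynomial. -/
def polyMinor (a b c d : ℕ) : Pol 8 4 :=
  (Matrix.of fun r c' => (MvPolynomial.X (![L8 a, L8 b, L8 c, L8 d] c', r) : Pol 8 4)).det

theorem algebraMap_polyMinor (a b c d : ℕ) :
    algebraMap (Pol 8 4) K4 (polyMinor a b c d) = d4 a b c d := by
  rw [polyMinor, RingHom.map_det]
  rfl

/-- The specialization of the generic vectors to points of the rational normal curve. -/
def evalCurve : Pol 8 4 →ₐ[ℚ] ℚ := MvPolynomial.aeval fun p => ((p.1 : ℕ) : ℚ) ^ (p.2 : ℕ)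

theorem evalCurve_polyMinor (a b c d : ℕ) :
    evalCurve (polyMinor a b c d) =
      (Matrix.vandermonde fun i => ((![L8 a, L8 b, L8 c, L8 d] i : ℕ) : ℚ)).det := by
  rw [polyMinor, AlgHom.map_det, ← Matrix.det_transpose]
  congr 1
  ext r c
  simp [evalCurve, Matrix.vandermonde]

theorem algebraMap_ne_zero_of_evalCurve {p : Pol 8 4} (h : evalCurve p ≠ 0) :
    algebraMap (Pol 8 4) K4 p ≠ 0 := by
  intro h0
  rw [map_eq_zero_iff _ (IsFractionRing.injective (Pol 8 4) K4)] at h0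
  exact h (by rw [h0, map_zero])

theorem d4_ne_zero {a b c d : ℕ} (h : [L8 a, L8 b, L8 c, L8 d].Nodup) : d4 a b c d ≠ 0 := by
  rw [← algebraMap_polyMinor]
  apply algebraMap_ne_zero_of_evalCurve
  rw [evalCurve_polyMinor, Matrix.det_vandermonde_ne_zero_iff]
  have h' : Function.Injective ![L8 a, L8 b, L8 c, L8 d] := by
    rw [← List.nodup_ofFn]
    simpa using h
  intro i j hij
  exact h' (Fin.ext (Nat.cast_injective hij))

theorem minor_combination_ne_zero :
    d4 4 5 6 7 * d4 2 3 4 8 - d4 2 3 4 7 * d4 4 5 6 8 ≠ 0 := by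
  simp only [← algebraMap_polyMinor, ← map_mul, ← map_sub]
  apply algebraMap_ne_zero_of_evalCurve
  simp only [map_sub, map_mul, evalCurve_polyMinor]
  simp [L8, Matrix.vandermonde, Matrix.det_succ_row_zero, Fin.sum_univ_succ, Fin.succAbove]
  norm_num

end Minors

section CrossRatio

theorem CR_swap_front (a b c d e f : ℕ) : CR b a c d e f = CR a b c d e f := by
  simp only [CR, d4_swap_one a b, neg_mul_neg]

theorem CR_swap_left (a b c d e f : ℕ) : CR a b d c e f = (CR a b c d e f)⁻¹ := by
  rw [CR, CR, inv_div, mul_comm, mul_comm (d4 a b d f)]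

theorem CR_swap_right (a b c d e f : ℕ) : CR a b c d f e = (CR a b c d e f)⁻¹ := by
  rw [CR, CR, inv_div]

variable {a b c d e f : ℕ}

theorem CR_ne_zero (h : [L8 a, L8 b, L8 c, L8 d, L8 e, L8 f].Nodup) : CR a b c d e f ≠ 0 := by
  apply div_ne_zero <;> apply mul_ne_zero <;> apply d4_ne_zero <;> simp at h ⊢ <;> tauto

theorem CR_swap_middle (h : [L8 a, L8 b, L8 c, L8 d, L8 e, L8 f].Nodup) :
    CR a b c e d f = 1 - CR a b c d e f := by
  have h1 : d4 a b c f ≠ 0 := d4_ne_zero (by simp at h ⊢; tauto)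
  have h2 : d4 a b d e ≠ 0 := d4_ne_zero (by simp at h ⊢; tauto)
  have hp := d4_plucker a b c d e f
  rw [CR, CR, d4_swap_three a b d e]
  field_simp
  linear_combination -hp

theorem CR_ne_one (h : [L8 a, L8 b, L8 c, L8 d, L8 e, L8 f].Nodup) : CR a b c d e f ≠ 1 := by
  have h1 : CR a b c e d f ≠ 0 := CR_ne_zero (by simp at h ⊢; tauto)
  rw [CR_swap_middle h, sub_ne_zero] at h1
  exact h1.symm

end CrossRatio

noncomputable section AltI

theorem Alt_add {N m n : ℕ} (s t : TP (FF N m) n) : Alt (s + t) = Alt s + Alt t := by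
  simp only [Alt, map_add, smul_add, Finset.sum_add_distrib]

theorem Alt_smul {N m n : ℕ} (r : ℚ) (t : TP (FF N m) n) : Alt (r • t) = r • Alt t := by
  simp only [Alt, map_smul, Finset.smul_sum]
  exact Finset.sum_congr rfl fun σ _ => smul_comm _ _ _

theorem Alt_neg {N m n : ℕ} (t : TP (FF N m) n) : Alt (-t) = -Alt t := by
  rw [← neg_one_smul ℚ, Alt_smul, neg_one_smul]

/-- The skew-symmetrized mod-products symbol of `Ĩ_{3,1}(x, y)`. -/
def altI (x y : K4) : TP K4 4 := Alt (Pit 4 (tI31 x y))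

theorem altI_inv_left {x : K4} (h0 : x ≠ 0) (h1 : x ≠ 1) (y : K4) :
    altI x⁻¹ y = -altI x y := by
  rw [altI, tI31_inv_left h0 h1, map_neg, Alt_neg, altI]

theorem altI_one_sub_left {x : K4} (h0 : x ≠ 0) (h1 : x ≠ 1) (y : K4) :
    altI (1 - x) y = -altI x y := by
  rw [altI, tI31_one_sub_left h0 h1, map_neg, Alt_neg, altI]

theorem altI_inv_right (x : K4) {y : K4} (h0 : y ≠ 0) (h1 : y ≠ 1) :
    altI x y⁻¹ = -altI x y := by
  rw [altI, tI31_inv_right _ h0 h1, map_neg, Alt_neg, altI]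

theorem altI_one_sub_right (x : K4) {y : K4} (h0 : y ≠ 0) (h1 : y ≠ 1) :
    altI x (1 - y) = -altI x y := by
  rw [altI, tI31_one_sub_right _ h0 h1, map_neg, Alt_neg, altI]

theorem altI_swap {x y : K4} (hx0 : x ≠ 0) (hx1 : x ≠ 1) (hy0 : y ≠ 0) (hy1 : y ≠ 1) :
    altI y x = -altI x y := by
  rw [altI, Pit_tI31_swap hx0 hx1 hy0 hy1, Alt_neg, altI]

/-- The field automorphism exchanging the vectors labelled `i` and `j`. -/
def swapAut (i j : ℕ) : K4 ≃+* K4 := permAut 8 4 (Equiv.swap (L8 i) (L8 j))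

theorem altI_swapAut {i j : ℕ} (h : L8 i ≠ L8 j) (x y : K4) :
    altI (swapAut i j x) (swapAut i j y) = -altI x y := by
  rw [altI, swapAut, ← tpMap_tI31, ← tpMap_Pit, Alt_tpMap_permAut, Equiv.Perm.sign_swap h]
  simp [altI]

/-- The transposition of two labels. -/
def swapLabel (i j k : ℕ) : ℕ := if L8 k = L8 i then j else if L8 k = L8 j then i else k

theorem swapAut_d4 (i j a b c d : ℕ) :
    swapAut i j (d4 a b c d) =
      d4 (swapLabel i j a) (swapLabel i j b) (swapLabel i j c) (swapLabel i j d) := by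
  have h (k : ℕ) : L8 (swapLabel i j k) = Equiv.swap (L8 i) (L8 j) (L8 k) := by
    rw [swapLabel, Equiv.swap_apply_def]
    split_ifs <;> rfl
  rw [swapAut, d4, permAut_dets, d4, h, h, h, h]
  congr 1
  ext s
  fin_cases s <;> rfl

theorem swapAut_CR (i j a b c d e f : ℕ) :
    swapAut i j (CR a b c d e f) =
      CR (swapLabel i j a) (swapLabel i j b) (swapLabel i j c) (swapLabel i j d)
        (swapLabel i j e) (swapLabel i j f) := by
  simp only [CR, map_div₀, map_mul, swapAut_d4]

variable {a b c d e f : ℕ}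

/-! As simp lemmas the following eight sort the first two and the last four arguments of the
cross-ratios in `altI`: the inequalities make the rewriting terminate. -/

@[simp]
theorem altI_CR_left_front (y : K4) (_h : b < a) :
    altI (CR a b c d e f) y = altI (CR b a c d e f) y := by
  rw [CR_swap_front]

@[simp]
theorem altI_CR_right_front (x : K4) (_h : b < a) :
    altI x (CR a b c d e f) = altI x (CR b a c d e f) := by
  rw [CR_swap_front]

@[simp]
theorem altI_CR_left_one (y : K4) (_h : d < c) (hg : [L8 a, L8 b, L8 c, L8 d, L8 e, L8 f].Nodup) :
    altI (CR a b c d e f) y = -altI (CR a b d c e f) y := by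
  rw [CR_swap_left a b c d, altI_inv_left (CR_ne_zero hg) (CR_ne_one hg), neg_neg]

@[simp]
theorem altI_CR_left_two (y : K4) (_h : e < d) (hg : [L8 a, L8 b, L8 c, L8 d, L8 e, L8 f].Nodup) :
    altI (CR a b c d e f) y = -altI (CR a b c e d f) y := by
  rw [CR_swap_middle hg, altI_one_sub_left (CR_ne_zero hg) (CR_ne_one hg), neg_neg]

@[simp]
theorem altI_CR_left_three (y : K4) (_h : f < e)
    (hg : [L8 a, L8 b, L8 c, L8 d, L8 e, L8 f].Nodup) :
    altI (CR a b c d e f) y = -altI (CR a b c d f e) y := by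
  rw [CR_swap_right a b c d e f, altI_inv_left (CR_ne_zero hg) (CR_ne_one hg), neg_neg]

@[simp]
theorem altI_CR_right_one (x : K4) (_h : d < c)
    (hg : [L8 a, L8 b, L8 c, L8 d, L8 e, L8 f].Nodup) :
    altI x (CR a b c d e f) = -altI x (CR a b d c e f) := by
  rw [CR_swap_left a b c d, altI_inv_right _ (CR_ne_zero hg) (CR_ne_one hg), neg_neg]

@[simp]
theorem altI_CR_right_two (x : K4) (_h : e < d)
    (hg : [L8 a, L8 b, L8 c, L8 d, L8 e, L8 f].Nodup) :
    altI x (CR a b c d e f) = -altI x (CR a b c e d f) := by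
  rw [CR_swap_middle hg, altI_one_sub_right _ (CR_ne_zero hg) (CR_ne_one hg), neg_neg]

@[simp]
theorem altI_CR_right_three (x : K4) (_h : f < e)
    (hg : [L8 a, L8 b, L8 c, L8 d, L8 e, L8 f].Nodup) :
    altI x (CR a b c d e f) = -altI x (CR a b c d f e) := by
  rw [CR_swap_right a b c d e f, altI_inv_right _ (CR_ne_zero hg) (CR_ne_one hg), neg_neg]

theorem altI_CR_swap {a' b' c' d' e' f' : ℕ}
    (h : [L8 a, L8 b, L8 c, L8 d, L8 e, L8 f].Nodup)
    (h' : [L8 a', L8 b', L8 c', L8 d', L8 e', L8 f'].Nodup) :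
    altI (CR a' b' c' d' e' f') (CR a b c d e f) =
      -altI (CR a b c d e f) (CR a' b' c' d' e' f') :=
  altI_swap (CR_ne_zero h) (CR_ne_one h) (CR_ne_zero h') (CR_ne_one h')

theorem altI_CR_swapLabel (i j : ℕ) (h : L8 i ≠ L8 j) (a b c d e f a' b' c' d' e' f' : ℕ) :
    altI (CR a b c d e f) (CR a' b' c' d' e' f') =
      -altI
        (CR (swapLabel i j a) (swapLabel i j b) (swapLabel i j c) (swapLabel i j d)
          (swapLabel i j e) (swapLabel i j f))
        (CR (swapLabel i j a') (swapLabel i j b') (swapLabel i j c') (swapLabel i j d')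
          (swapLabel i j e') (swapLabel i j f')) := by
  rw [← swapAut_CR, ← swapAut_CR, altI_swapAut h, neg_neg]

end AltI

noncomputable section Reduction

theorem rho_two_div_rho_one : rho 2 / rho 1 = CR 2 3 4 1 7 8 := by
  simp only [rho, M6, CR, Nat.reduceSub, Nat.reduceAdd, Nat.reduceMod]
  rw [d4_swap_two 2 1 3 8, d4_swap_one 1 2 3 8, d4_swap_two 2 1 3 7, d4_swap_one 1 2 3 7,
    div_div_div_eq]
  simp

section FiveTerm

variable {a b c d e f g : ℕ}

theorem CR_mul_CR (h : [L8 a, L8 b, L8 c, L8 d, L8 e, L8 f, L8 g].Nodup) :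
    CR a b c d e f * CR a b c d g e = CR a b c d g f := by
  have h1 : d4 a b c e ≠ 0 := d4_ne_zero (by simp at h ⊢; tauto)
  have h2 : d4 a b d e ≠ 0 := d4_ne_zero (by simp at h ⊢; tauto)
  simp only [CR]
  field_simp

theorem one_sub_CR_mul_CR (h : [L8 a, L8 b, L8 c, L8 d, L8 e, L8 f, L8 g].Nodup) :
    1 - CR a b c d e f * CR a b c d g e = CR a b c g d f := by
  rw [CR_mul_CR h, CR_swap_middle (by simp at h ⊢; tauto), sub_sub_cancel]

theorem one_sub_CR_div_left (h : [L8 a, L8 b, L8 c, L8 d, L8 e, L8 f, L8 g].Nodup) :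
    (1 - CR a b c d e f) / (1 - CR a b c d e f * CR a b c d g e) = CR a b e g f d := by
  have h1 : d4 a b c d ≠ 0 := d4_ne_zero (by simp at h ⊢; tauto)
  have h2 : d4 a b c f ≠ 0 := d4_ne_zero (by simp at h ⊢; tauto)
  rw [one_sub_CR_mul_CR h, ← CR_swap_middle (by simp at h ⊢; tauto)]
  simp only [CR]
  field_simp

theorem one_sub_CR_div_right (h : [L8 a, L8 b, L8 c, L8 d, L8 e, L8 f, L8 g].Nodup) :
    (1 - CR a b c d g e) / (1 - CR a b c d e f * CR a b c d g e) = CR a b g c e f := by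
  have h1 : d4 a b c d ≠ 0 := d4_ne_zero (by simp at h ⊢; tauto)
  have h2 : d4 a b g d ≠ 0 := d4_ne_zero (by simp at h ⊢; tauto)
  rw [one_sub_CR_mul_CR h, ← CR_swap_middle (by simp at h ⊢; tauto)]
  simp only [CR]
  field_simp

end FiveTerm

theorem eq_zero_of_eq_neg {M : Type} [AddCommGroup M] [Module ℚ M] {v : M} (h : v = -v) :
    v = 0 := by
  have h2 : (2 : ℚ) • v = 0 := by rw [two_smul]; nth_rewrite 2 [h]; exact add_neg_cancel v
  exact (smul_eq_zero.mp h2).resolve_left two_ne_zero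

theorem altI_CR_4_8_7_2_3_5 :
    altI (CR 2 3 4 1 7 8) (CR 4 8 7 2 3 5) = altI (CR 3 4 2 5 6 7) (CR 6 7 1 3 4 5) := by
  rw [altI_CR_swapLabel 1 2 (by simp [L8]), altI_CR_swapLabel 1 4 (by simp [L8]),
    altI_CR_swapLabel 1 6 (by simp [L8]), altI_CR_swapLabel 1 8 (by simp [L8]),
    altI_CR_swapLabel 1 7 (by simp [L8]), altI_CR_swapLabel 1 5 (by simp [L8])]
  simp [swapLabel, L8]

theorem altI_CR_4_8_7_2_6_3 :
    altI (CR 2 3 4 1 7 8) (CR 4 8 7 2 6 3) = altI (CR 2 3 4 1 7 8) (CR 4 8 7 2 3 5) := by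
  rw [altI_CR_swapLabel 5 6 (by simp [L8])]
  simp [swapLabel, L8]

theorem altI_CR_4_8_2_3_5_6 : altI (CR 2 3 1 4 7 8) (CR 4 8 2 3 5 6) = 0 := by
  have h : altI (CR 2 3 1 4 7 8) (CR 4 8 2 3 5 6) = -altI (CR 2 3 1 4 7 8) (CR 4 8 2 3 5 6) := by
    conv_lhs => rw [altI_CR_swapLabel 2 4 (by simp [L8]), altI_CR_swapLabel 3 8 (by simp [L8]),
      altI_CR_swapLabel 1 5 (by simp [L8]), altI_CR_swapLabel 6 7 (by simp [L8])]
    rw [altI_CR_swap (by simp [L8, swapLabel]) (by simp [L8, swapLabel])]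
    simp [swapLabel, L8]
  exact eq_zero_of_eq_neg h

theorem altI_CR_2_4_3_5_8_6 :
    altI (CR 2 3 4 1 7 8) (CR 2 4 3 5 8 6) = altI (CR 2 3 4 1 7 8) (CR 3 4 2 6 8 5) := by
  rw [altI_CR_swapLabel 2 3 (by simp [L8])]
  simp [swapLabel, L8]

theorem altI_CR_4_8_7_6_2_5 :
    altI (CR 2 3 4 1 7 8) (CR 4 8 7 6 2 5) = altI (CR 2 3 4 1 7 8) (CR 4 8 7 6 5 3) := by
  rw [altI_CR_swapLabel 2 3 (by simp [L8])]
  simp [swapLabel, L8]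

theorem altI_CR_4_5_2_6_3_8 :
    altI (CR 2 3 4 1 7 8) (CR 4 5 2 6 3 8) = altI (CR 2 3 4 1 7 8) (CR 4 6 5 2 3 8) := by
  rw [altI_CR_swapLabel 5 6 (by simp [L8])]
  simp [swapLabel, L8]

theorem altI_CR_4_6_5_2_3_8 :
    altI (CR 2 3 4 1 7 8) (CR 4 6 5 2 3 8) = -altI (CR 2 3 4 1 7 8) (CR 4 8 7 6 5 3) := by
  rw [altI_CR_swap (by simp [L8]) (by simp [L8]), altI_CR_swapLabel 1 5 (by simp [L8]),
    altI_CR_swapLabel 2 4 (by simp [L8]), altI_CR_swapLabel 2 3 (by simp [L8]),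
    altI_CR_swapLabel 2 8 (by simp [L8]), altI_CR_swapLabel 2 7 (by simp [L8]),
    altI_CR_swapLabel 2 6 (by simp [L8])]
  simp [swapLabel, L8]

theorem CR_4_6_mul_CR_4_3 : CR 4 6 5 2 3 8 * CR 4 3 2 5 6 8 = CR 4 8 6 3 2 5 := by
  have h1 : d4 2 3 4 6 ≠ 0 := d4_ne_zero (by simp [L8])
  have h2 : d4 3 4 5 6 ≠ 0 := d4_ne_zero (by simp [L8])
  simp [CR]
  field_simp

theorem CR_4_6_one_sub_div :
    (1 - CR 4 6 5 2 3 8) / (1 - CR 4 6 5 2 3 8 * CR 4 3 2 5 6 8) = CR 2 4 3 5 8 6 := by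
  rw [CR_4_6_mul_CR_4_3, ← CR_swap_middle (by simp [L8]), ← CR_swap_middle (by simp [L8])]
  have h1 : d4 2 4 6 8 ≠ 0 := d4_ne_zero (by simp [L8])
  have h2 : d4 3 4 6 8 ≠ 0 := d4_ne_zero (by simp [L8])
  have h3 : d4 4 5 6 8 ≠ 0 := d4_ne_zero (by simp [L8])
  simp [CR]
  field_simp

theorem CR_4_3_one_sub_div :
    (1 - CR 4 3 2 5 6 8) / (1 - CR 4 6 5 2 3 8 * CR 4 3 2 5 6 8) = CR 4 5 2 6 3 8 := by
  rw [CR_4_6_mul_CR_4_3, ← CR_swap_middle (by simp [L8]), ← CR_swap_middle (by simp [L8])]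
  have h1 : d4 2 3 4 8 ≠ 0 := d4_ne_zero (by simp [L8])
  have h2 : d4 3 4 5 8 ≠ 0 := d4_ne_zero (by simp [L8])
  have h3 : d4 3 4 6 8 ≠ 0 := d4_ne_zero (by simp [L8])
  simp [CR]
  field_simp

end Reduction

noncomputable section RhoTerms

theorem rho_two : rho 2 = d4 2 3 4 7 / d4 2 3 4 8 := rfl
theorem rho_three : rho 3 = d4 3 4 5 7 / d4 3 4 5 8 := rfl
theorem rho_four : rho 4 = d4 4 5 6 7 / d4 4 5 6 8 := rfl

theorem rr_three_two : rr 3 2 = -(d4 2 3 4 5 * d4 3 4 7 8) / (d4 2 3 4 8 * d4 3 4 5 8) := by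
  have h1 : d4 2 3 4 8 ≠ 0 := d4_ne_zero (by simp [L8])
  have h2 : d4 3 4 5 8 ≠ 0 := d4_ne_zero (by simp [L8])
  have hp := d4_plucker 3 4 2 5 7 8
  simp at hp
  rw [rr, rho_two, rho_three]
  field_simp
  linear_combination hp

theorem rr_three_four : rr 3 4 = d4 3 4 5 6 * d4 4 5 7 8 / (d4 3 4 5 8 * d4 4 5 6 8) := by
  have h1 : d4 3 4 5 8 ≠ 0 := d4_ne_zero (by simp [L8])
  have h2 : d4 4 5 6 8 ≠ 0 := d4_ne_zero (by simp [L8])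
  have hp := d4_plucker 4 5 3 6 7 8
  simp at hp
  rw [rr, rho_four, rho_three]
  field_simp
  linear_combination -hp

theorem CR_3_4_mul_CR_4_8 : CR 3 4 2 6 8 5 * CR 4 8 7 6 5 3 = (rr 3 2 / rr 3 4)⁻¹ := by
  rw [rr_three_two, rr_three_four]
  have h1 : d4 3 4 5 6 ≠ 0 := d4_ne_zero (by simp [L8])
  have h2 : d4 3 4 6 8 ≠ 0 := d4_ne_zero (by simp [L8])
  have h3 : d4 3 4 7 8 ≠ 0 := d4_ne_zero (by simp [L8])
  have h4 : d4 4 5 6 8 ≠ 0 := d4_ne_zero (by simp [L8])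
  have h5 : d4 2 3 4 8 ≠ 0 := d4_ne_zero (by simp [L8])
  have h6 : d4 3 4 5 8 ≠ 0 := d4_ne_zero (by simp [L8])
  have h7 : d4 4 5 7 8 ≠ 0 := d4_ne_zero (by simp [L8])
  have h8 : d4 2 3 4 5 ≠ 0 := d4_ne_zero (by simp [L8])
  simp [CR]
  field_simp

theorem rr_four_two_ne_zero : rr 4 2 ≠ 0 := by
  have h1 : d4 2 3 4 8 ≠ 0 := d4_ne_zero (by simp [L8])
  have h2 : d4 4 5 6 8 ≠ 0 := d4_ne_zero (by simp [L8])
  rw [rr, rho_two, rho_four, div_sub_div _ _ h2 h1, mul_comm (d4 4 5 6 8) (d4 2 3 4 7)]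
  exact div_ne_zero minor_combination_ne_zero (mul_ne_zero h2 h1)

theorem rr_three_two_ne_zero : rr 3 2 ≠ 0 := by
  rw [rr_three_two]
  refine div_ne_zero (neg_ne_zero.mpr (mul_ne_zero ?_ ?_)) (mul_ne_zero ?_ ?_) <;>
    exact d4_ne_zero (by simp [L8])

theorem rr_three_four_ne_zero : rr 3 4 ≠ 0 := by
  rw [rr_three_four]
  refine div_ne_zero (mul_ne_zero ?_ ?_) (mul_ne_zero ?_ ?_) <;> exact d4_ne_zero (by simp [L8])

theorem rr_div_rr_ne_one : rr 3 2 / rr 3 4 ≠ 1 := by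
  rw [Ne, div_eq_one_iff_eq rr_three_four_ne_zero]
  intro h
  apply rr_four_two_ne_zero
  simp only [rr] at h ⊢
  linear_combination h

theorem one_sub_CR_4_8_div :
    (1 - CR 4 8 7 6 5 3) / (1 - CR 3 4 2 6 8 5 * CR 4 8 7 6 5 3) =
      d4 4 6 7 8 * d4 2 3 4 5 / (d4 4 5 6 7 * d4 2 3 4 8 - d4 2 3 4 7 * d4 4 5 6 8) := by
  have h0 : 1 - (rr 3 2 / rr 3 4)⁻¹ = rr 4 2 / rr 3 2 := by
    have h := rr_three_two_ne_zero
    rw [inv_div]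
    field_simp
    simp only [rr]
    ring
  have h := minor_combination_ne_zero
  have h1 : d4 2 3 4 8 ≠ 0 := d4_ne_zero (by simp [L8])
  have h2 : d4 4 5 6 8 ≠ 0 := d4_ne_zero (by simp [L8])
  have h3 : d4 3 4 5 8 ≠ 0 := d4_ne_zero (by simp [L8])
  have h4 : d4 3 4 7 8 ≠ 0 := d4_ne_zero (by simp [L8])
  rw [CR_3_4_mul_CR_4_8, h0, ← CR_swap_middle (by simp [L8]), rr_three_two, rr, rho_two, rho_four,
    div_sub_div _ _ h2 h1, mul_comm (d4 4 5 6 8) (d4 2 3 4 7)]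
  simp [CR]
  field_simp

theorem one_sub_CR_mul_CR_swapped :
    1 - CR 3 4 2 5 8 6 * CR 4 8 7 5 6 3 =
      (1 - CR 3 4 2 5 8 6) * (1 - (rr 3 2 / rr 3 4)⁻¹) := by
  have h1 : d4 2 3 4 6 ≠ 0 := d4_ne_zero (by simp [L8])
  have h2 : d4 3 4 7 8 ≠ 0 := d4_ne_zero (by simp [L8])
  have h3 : d4 4 5 6 8 ≠ 0 := d4_ne_zero (by simp [L8])
  have h4 : d4 3 4 5 8 ≠ 0 := d4_ne_zero (by simp [L8])
  have h5 : d4 2 3 4 8 ≠ 0 := d4_ne_zero (by simp [L8])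
  have h6 : d4 2 3 4 5 ≠ 0 := d4_ne_zero (by simp [L8])
  have hp := d4_plucker 3 4 2 5 6 8
  have hq := d4_plucker 4 8 3 5 6 7
  simp at hp hq
  rw [← CR_swap_middle (by simp [L8]), rr_three_two, rr_three_four, inv_div]
  simp [CR]
  field_simp
  linear_combination -d4 3 4 7 8 * d4 4 5 6 8 * hp - d4 2 3 4 8 * d4 3 4 5 6 * hq

end RhoTerms

noncomputable section FinalReduction

theorem altI_one_sub_CR_3_4_div :
    altI (CR 2 3 4 1 7 8)
        ((1 - CR 3 4 2 6 8 5) / (1 - CR 3 4 2 6 8 5 * CR 4 8 7 6 5 3)) =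
      altI (CR 2 3 4 1 7 8) (rr 3 2 / rr 3 4) := by
  have h0 : rr 3 2 / rr 3 4 ≠ 0 := div_ne_zero rr_three_two_ne_zero rr_three_four_ne_zero
  have h1 := rr_div_rr_ne_one
  have h2 : (rr 3 2 / rr 3 4)⁻¹ ≠ 0 := inv_ne_zero h0
  have h3 : (rr 3 2 / rr 3 4)⁻¹ ≠ 1 := fun h => h1 (inv_eq_one.mp h)
  have h4 : 1 - (rr 3 2 / rr 3 4)⁻¹ ≠ 0 := sub_ne_zero.mpr h3.symm
  have h5 : 1 - (rr 3 2 / rr 3 4)⁻¹ ≠ 1 := fun h => h2 (by simpa using h)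
  have h6 : 1 - CR 3 4 2 5 8 6 ≠ 0 := sub_ne_zero.mpr (CR_ne_one (by simp [L8])).symm
  have h7 : (1 - CR 3 4 2 5 8 6) / (1 - CR 3 4 2 5 8 6 * CR 4 8 7 5 6 3) =
      (1 - (rr 3 2 / rr 3 4)⁻¹)⁻¹ := by
    rw [one_sub_CR_mul_CR_swapped]
    field_simp
  have h := altI_swapAut (i := 5) (j := 6) (by simp [L8]) (CR 2 3 4 1 7 8)
    ((1 - CR 3 4 2 6 8 5) / (1 - CR 3 4 2 6 8 5 * CR 4 8 7 6 5 3))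
  simp only [map_div₀, map_sub, map_mul, map_one, swapAut_CR] at h
  simp only [swapLabel, L8, Fin.mk.injEq, Nat.reduceSub, Nat.reduceMod, Nat.reduceEqDiff, if_true,
    if_false] at h
  rw [h7, altI_inv_right _ h4 h5, altI_one_sub_right _ h2 h3, altI_inv_right _ h0 h1] at h
  simpa using h.symm

theorem altI_one_sub_CR_mul_CR :
    altI (CR 2 3 4 1 7 8) (1 - CR 3 4 2 6 8 5 * CR 4 8 7 6 5 3) =
      altI (CR 2 3 4 1 7 8) (rr 3 2 / rr 3 4) := by
  have h0 : rr 3 2 / rr 3 4 ≠ 0 := div_ne_zero rr_three_two_ne_zero rr_three_four_ne_zero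
  have h1 := rr_div_rr_ne_one
  rw [CR_3_4_mul_CR_4_8,
    altI_one_sub_right _ (inv_ne_zero h0) (fun h => h1 (inv_eq_one.mp h)),
    altI_inv_right _ h0 h1, neg_neg]

theorem altI_one_sub_CR_4_8_div :
    altI (CR 2 3 4 1 7 8)
      ((1 - CR 4 8 7 6 5 3) / (1 - CR 3 4 2 6 8 5 * CR 4 8 7 6 5 3)) = 0 := by
  rw [one_sub_CR_4_8_div]
  have h := altI_swapAut (i := 2) (j := 3) (by simp [L8]) (CR 2 3 4 1 7 8)
    (d4 4 6 7 8 * d4 2 3 4 5 / (d4 4 5 6 7 * d4 2 3 4 8 - d4 2 3 4 7 * d4 4 5 6 8))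
  simp only [map_div₀, map_sub, map_mul, swapAut_CR, swapAut_d4] at h
  simp only [swapLabel, L8, Fin.mk.injEq, Nat.reduceSub, Nat.reduceMod, Nat.reduceEqDiff, if_true,
    if_false] at h
  rw [CR_swap_front, d4_swap_one 2 3 4 5, d4_swap_one 2 3 4 7, d4_swap_one 2 3 4 8, mul_neg, mul_neg,
    neg_mul, ← neg_sub', neg_div_neg_eq] at h
  exact eq_zero_of_eq_neg h

theorem altI_rr_div_rho :
    altI (rr 1 2 / rho 1) (rr 3 2 / rr 3 4) = -altI (CR 2 3 4 1 7 8) (rr 3 2 / rr 3 4) := by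
  have h0 : CR 2 3 4 1 7 8 ≠ 0 := CR_ne_zero (by simp [L8])
  have h : rho 1 ≠ 0 := by
    intro h
    rw [← rho_two_div_rho_one, h, div_zero] at h0
    exact h0 rfl
  rw [rr, sub_div, div_self h, rho_two_div_rho_one,
    altI_one_sub_left h0 (CR_ne_one (by simp [L8]))]

theorem Alt_Pit_Vc (z x y : K4) :
    Alt (Pit 4 (Vc z x y)) =
      altI z x + altI z y + altI z ((1 - x) / (1 - x * y)) + altI z (1 - x * y)
        + altI z ((1 - y) / (1 - x * y)) := by
  simp only [Vc, map_add, Alt_add, altI]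

theorem Alt_Pit_Vc_one :
    Alt (Pit 4 (Vc (rho 2 / rho 1) (CR 3 4 2 6 8 5) (CR 4 8 7 6 5 3))) =
      altI (CR 2 3 4 1 7 8) (CR 3 4 2 6 8 5) + altI (CR 2 3 4 1 7 8) (CR 4 8 7 6 5 3)
        + (2 : ℚ) • altI (CR 2 3 4 1 7 8) (rr 3 2 / rr 3 4) := by
  rw [Alt_Pit_Vc, rho_two_div_rho_one, altI_one_sub_CR_3_4_div, altI_one_sub_CR_mul_CR,
    altI_one_sub_CR_4_8_div]
  module

theorem Alt_Pit_Vc_two :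
    Alt (Pit 4 (Vc (rho 2 / rho 1) (CR 4 8 7 2 3 5) (CR 4 8 7 2 6 3))) =
      (2 : ℚ) • altI (CR 3 4 2 5 6 7) (CR 6 7 1 3 4 5)
        + (2 : ℚ) • altI (CR 2 3 4 1 7 8) (CR 4 8 7 6 5 3) := by
  rw [Alt_Pit_Vc, rho_two_div_rho_one, one_sub_CR_div_left (by simp [L8]),
    one_sub_CR_div_right (by simp [L8]), one_sub_CR_mul_CR (by simp [L8]), altI_CR_4_8_7_2_6_3,
    altI_CR_4_8_7_2_3_5, altI_CR_4_8_7_6_2_5]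
  have h1 : altI (CR 2 3 4 1 7 8) (CR 4 8 3 6 5 2) = 0 := by
    simp [L8, altI_CR_4_8_2_3_5_6]
  have h2 : altI (CR 2 3 4 1 7 8) (CR 4 8 6 7 3 5) =
      altI (CR 2 3 4 1 7 8) (CR 4 8 7 6 5 3) := by
    simp [L8]
  rw [h1, h2]
  module

theorem Alt_Pit_Vc_three :
    Alt (Pit 4 (Vc (rho 2 / rho 1) (CR 4 6 5 2 3 8) (CR 4 3 2 5 6 8))) =
      (2 : ℚ) • altI (CR 2 3 4 1 7 8) (CR 3 4 2 6 8 5)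
        - (2 : ℚ) • altI (CR 2 3 4 1 7 8) (CR 4 8 7 6 5 3) := by
  rw [Alt_Pit_Vc, rho_two_div_rho_one, CR_4_6_one_sub_div, CR_4_3_one_sub_div, CR_4_6_mul_CR_4_3,
    ← CR_swap_middle (by simp [L8]), altI_CR_2_4_3_5_8_6, altI_CR_4_5_2_6_3_8,
    altI_CR_4_6_5_2_3_8]
  have h1 : altI (CR 2 3 4 1 7 8) (CR 4 8 6 2 3 5) = 0 := by
    simp [L8, altI_CR_4_8_2_3_5_6]
  have h2 : altI (CR 2 3 4 1 7 8) (CR 4 3 2 5 6 8) =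
      altI (CR 2 3 4 1 7 8) (CR 3 4 2 6 8 5) := by
    simp [L8]
  rw [h1, h2]
  module

end FinalReduction

end GrassPoly

open GrassPoly

/-- Lemma `gr4li4_2`. -/
theorem lemma_gr4li4_2 :
    Alt (Pit 4 (tI31 (rr 1 2 / rho 1) (rr 3 2 / rr 3 4)
        + tI31 (CR 3 4 2 5 6 7) (CR 6 7 1 3 4 5))) =
      Alt (Pit 4 (
        - (2 : ℚ)⁻¹ • Vc (rho 2 / rho 1) (CR 3 4 2 6 8 5) (CR 4 8 7 6 5 3)
        + (2 : ℚ)⁻¹ • Vc (rho 2 / rho 1) (CR 4 8 7 2 3 5) (CR 4 8 7 2 6 3)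
        + (4 : ℚ)⁻¹ • Vc (rho 2 / rho 1) (CR 4 6 5 2 3 8) (CR 4 3 2 5 6 8))) := by
  have h : Alt (Pit 4 (tI31 (rr 1 2 / rho 1) (rr 3 2 / rr 3 4))) = _ := altI_rr_div_rho
  simp only [map_add, map_smul, Alt_add, Alt_smul, Alt_Pit_Vc_one, Alt_Pit_Vc_two,
    Alt_Pit_Vc_three, h]
  rw [← altI]
  module
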